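/- Let d ≥ 1, let q > 1 + d/2 and 0 ≤ p ≤ q be real numbers, and let C₁, C₂ > 0. Then there exists a constant C = C(p, C₁, C₂) > 0 with the following property: for every Schwartz map g : ℝ^d → ℝ^d such that ‖g‖_{H^q} < C₁, inf_{x∈ℝ^d} det(I + dg(x)) > C₂, and φ := id + g is a bijection of ℝ^d, and for every Schwartz function u : ℝ^d → ℂ, the composition u∘φ is again a Schwartz function and ‖u∘φ‖_{H^p} ≤ C ‖u‖_{H^p}. (The right-translation operator R_φ : u ↦ u∘φ is locally bounded on H^p, uniformly over such φ.) -/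

import Mathlib

open MeasureTheory Complex
open scoped FourierTransform BigOperators

noncomputable section

/-- Euclidean space `ℝ^d`. -/
abbrev Ed (d : ℕ) : Type := EuclideanSpace ℝ (Fin d)

/-- The Sobolev `H^s`-norm of a function on `ℝ^d`, defined via the Fourier transform:
`‖f‖_{H^s} = (∫ (1+‖ξ‖²)^s ‖𝓕f(ξ)‖² dξ)^{1/2}`. -/
noncomputable def HNorm {d : ℕ} (s : ℝ) (f : Ed d → ℂ) : ℝ :=
  (∫ ξ : Ed d, (1 + ‖ξ‖ ^ 2) ^ s * ‖𝓕 f ξ‖ ^ 2) ^ ((1 : ℝ) / 2)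

/-- The Sobolev `H^s`-norm of an `ℝ^d`-valued map, `‖g‖_{H^s}² = Σᵢ ‖gᵢ‖_{H^s}²`. -/
noncomputable def HNormV {d : ℕ} (s : ℝ) (g : Ed d → Ed d) : ℝ :=
  (∑ i : Fin d, HNorm s (fun x => ((g x i : ℝ) : ℂ)) ^ 2) ^ ((1 : ℝ) / 2)

section Helpers

open scoped SchwartzMap ENNReal LineDeriv
open Set

/-- The square of the Sobolev `H^s`-norm of a Schwartz function, as an extended nonnegative real. -/
def sobolevEnergy {d : ℕ} (s : ℝ) (f : 𝓢(Ed d, ℂ)) : ℝ≥0∞ :=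
  ∫⁻ ξ, ENNReal.ofReal ((1 + ‖ξ‖ ^ 2) ^ s * ‖𝓕 f ξ‖ ^ 2)

section SobolevEnergy

variable {d : ℕ}

lemma one_add_norm_sq_pos (ξ : Ed d) : 0 < 1 + ‖ξ‖ ^ 2 := by positivity

lemma measurable_sobolevEnergy_integrand (s : ℝ) (f : 𝓢(Ed d, ℂ)) :
    Measurable fun ξ : Ed d => ENNReal.ofReal ((1 + ‖ξ‖ ^ 2) ^ s * ‖𝓕 f ξ‖ ^ 2) := by
  have := (𝓕 f).continuous.measurable
  fun_prop

lemma sobolevEnergy_ne_top (s : ℝ) (f : 𝓢(Ed d, ℂ)) : sobolevEnergy s f ≠ ⊤ := by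
  set h : 𝓢(Ed d, ℂ) := SchwartzMap.smulLeftCLM ℂ (fun ξ : Ed d => (1 + ‖ξ‖ ^ 2) ^ (s / 2)) (𝓕 f)
    with h_def
  have hint : Integrable fun ξ => ‖h ξ‖ ^ 2 := (h.memLp 2 volume).integrable_norm_pow (by norm_num)
  have key : ∀ ξ : Ed d, (1 + ‖ξ‖ ^ 2) ^ s * ‖𝓕 f ξ‖ ^ 2 = ‖h ξ‖ ^ 2 := by
    intro ξ
    have hpos := one_add_norm_sq_pos ξ
    rw [h_def, SchwartzMap.smulLeftCLM_apply_apply (by fun_prop), norm_smul, mul_pow,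
      Real.norm_of_nonneg (by positivity), ← Real.rpow_mul_natCast hpos.le]
    norm_num
  unfold sobolevEnergy
  simp_rw [key]
  exact hint.lintegral_lt_top.ne

lemma HNorm_eq_sobolevEnergy (s : ℝ) (f : 𝓢(Ed d, ℂ)) :
    HNorm s f = (sobolevEnergy s f).toReal ^ ((1 : ℝ) / 2) := by
  unfold HNorm sobolevEnergy
  rw [integral_eq_lintegral_of_nonneg_ae]
  · rfl
  · exact Filter.Eventually.of_forall fun ξ => by dsimp; positivity
  · have := (𝓕 f).continuous.measurable
    rw [SchwartzMap.fourier_coe] at this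
    exact Measurable.aestronglyMeasurable (by fun_prop)

lemma sobolevEnergy_mono {s t : ℝ} (h : s ≤ t) (f : 𝓢(Ed d, ℂ)) :
    sobolevEnergy s f ≤ sobolevEnergy t f := by
  refine lintegral_mono fun ξ => ENNReal.ofReal_le_ofReal ?_
  gcongr
  nlinarith [sq_nonneg ‖ξ‖]

lemma sobolevEnergy_add_le (s : ℝ) (f g : 𝓢(Ed d, ℂ)) :
    sobolevEnergy s (f + g) ≤ 2 * (sobolevEnergy s f + sobolevEnergy s g) := by
  unfold sobolevEnergy
  rw [← lintegral_add_left (measurable_sobolevEnergy_integrand s f),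
    ← lintegral_const_mul' _ _ (by norm_num)]
  refine lintegral_mono fun ξ => ?_
  have hpos := one_add_norm_sq_pos ξ
  rw [← ENNReal.ofReal_add (by positivity) (by positivity)]
  refine le_of_le_of_eq ?_ (congrArg (· * _) (ENNReal.ofReal_ofNat 2))
  rw [← ENNReal.ofReal_mul zero_le_two]
  refine ENNReal.ofReal_le_ofReal ?_
  rw [FourierTransform.fourier_add, _root_.add_apply, ← mul_add, mul_left_comm]
  gcongr
  have := norm_add_le (𝓕 f ξ) (𝓕 g ξ)
  nlinarith [norm_nonneg (𝓕 f ξ + 𝓕 g ξ), sq_nonneg (‖𝓕 f ξ‖ - ‖𝓕 g ξ‖)]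

lemma sobolevEnergy_zero (s : ℝ) : sobolevEnergy s (0 : 𝓢(Ed d, ℂ)) = 0 := by
  simp [sobolevEnergy, FourierTransform.fourier_zero]

lemma sobolevEnergy_sum_le {ι : Type*} (s : ℝ) (A : Finset ι) (f : ι → 𝓢(Ed d, ℂ)) :
    sobolevEnergy s (∑ i ∈ A, f i) ≤ 2 ^ A.card * ∑ i ∈ A, sobolevEnergy s (f i) := by
  classical
  induction A using Finset.induction_on with
  | empty => simp [sobolevEnergy_zero]
  | insert i A hi ih =>
    rw [Finset.sum_insert hi, Finset.sum_insert hi, Finset.card_insert_of_notMem hi, pow_succ',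
      mul_assoc, mul_add]
    refine (sobolevEnergy_add_le s _ _).trans ?_
    gcongr
    exact le_mul_of_one_le_left zero_le (one_le_pow₀ (by norm_num))

lemma norm_fourier_lineDeriv_sq (f : 𝓢(Ed d, ℂ)) (v ξ : Ed d) :
    ‖𝓕 (∂_{v} f) ξ‖ ^ 2 = (2 * Real.pi) ^ 2 * (inner ℝ ξ v ^ 2 * ‖𝓕 f ξ‖ ^ 2) := by
  rw [SchwartzMap.fourier_lineDerivOp_eq, _root_.smul_apply,
    SchwartzMap.smulLeftCLM_apply_apply (by fun_prop), norm_smul, norm_smul, mul_pow, mul_pow]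
  simp [abs_of_pos Real.pi_pos]

lemma sobolevEnergy_lineDeriv_le (s : ℝ) (f : 𝓢(Ed d, ℂ)) (j : Fin d) :
    sobolevEnergy s (∂_{EuclideanSpace.single j (1 : ℝ)} f) ≤
      ENNReal.ofReal ((2 * Real.pi) ^ 2) * sobolevEnergy (s + 1) f := by
  unfold sobolevEnergy
  rw [← lintegral_const_mul' _ _ ENNReal.ofReal_ne_top]
  refine lintegral_mono fun ξ => ?_
  have hpos := one_add_norm_sq_pos ξ
  rw [← ENNReal.ofReal_mul (by positivity)]
  refine ENNReal.ofReal_le_ofReal ?_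
  rw [norm_fourier_lineDeriv_sq, mul_left_comm, Real.rpow_add_one hpos.ne', mul_assoc]
  gcongr
  rw [← sq_abs, ← Real.norm_eq_abs]
  have := norm_inner_le_norm (𝕜 := ℝ) ξ (EuclideanSpace.single j (1 : ℝ))
  simp only [PiLp.norm_single, norm_one, mul_one] at this
  nlinarith [norm_nonneg (inner ℝ ξ (EuclideanSpace.single j (1 : ℝ)))]

lemma sobolevEnergy_add_one_le (s : ℝ) (f : 𝓢(Ed d, ℂ)) :
    sobolevEnergy (s + 1) f ≤ sobolevEnergy s f +
      ∑ j : Fin d, sobolevEnergy s (∂_{EuclideanSpace.single j (1 : ℝ)} f) := by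
  unfold sobolevEnergy
  rw [← lintegral_finsetSum _ fun j _ => measurable_sobolevEnergy_integrand s _,
    ← lintegral_add_left (measurable_sobolevEnergy_integrand s f)]
  refine lintegral_mono fun ξ => ?_
  have hpos := one_add_norm_sq_pos ξ
  rw [← ENNReal.ofReal_sum_of_nonneg fun _ _ => by positivity,
    ← ENNReal.ofReal_add (by positivity) (Finset.sum_nonneg fun _ _ => by positivity)]
  refine ENNReal.ofReal_le_ofReal ?_
  simp_rw [norm_fourier_lineDeriv_sq]
  rw [← Finset.mul_sum, ← Finset.mul_sum, ← Finset.sum_mul, ← mul_add,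
    Real.rpow_add_one hpos.ne', mul_assoc]
  gcongr
  have hsum : ∑ j : Fin d, inner ℝ ξ (EuclideanSpace.single j (1 : ℝ)) ^ 2 = ‖ξ‖ ^ 2 := by
    simp [EuclideanSpace.norm_sq_eq, EuclideanSpace.inner_single_right]
  have hpi : 1 ≤ (2 * Real.pi) ^ 2 := by nlinarith [Real.two_le_pi]
  rw [hsum, one_add_mul]
  linarith [mul_le_mul_of_nonneg_right hpi (show 0 ≤ ‖ξ‖ ^ 2 * ‖𝓕 f ξ‖ ^ 2 by positivity)]

lemma sobolevEnergy_zero_eq (f : 𝓢(Ed d, ℂ)) :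
    sobolevEnergy 0 f = ∫⁻ x, ENNReal.ofReal (‖f x‖ ^ 2) := by
  have hint (h : 𝓢(Ed d, ℂ)) : Integrable fun ξ => ‖h ξ‖ ^ 2 :=
    (h.memLp 2 volume).integrable_norm_pow (by norm_num)
  simp only [sobolevEnergy, Real.rpow_zero, one_mul]
  rw [← ofReal_integral_eq_lintegral_ofReal (hint _) (.of_forall fun _ => by dsimp; positivity),
    ← ofReal_integral_eq_lintegral_ofReal (hint _) (.of_forall fun _ => by dsimp; positivity),
    SchwartzMap.integral_norm_sq_fourier]

end SobolevEnergy

section Product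

variable {d : ℕ}

lemma one_add_norm_add_sq_rpow_mul_le {r s : ℝ} (hs : 0 ≤ s) (hsr : s ≤ r) (x y : Ed d) :
    (1 + ‖x + y‖ ^ 2) ^ s * ((1 + ‖x‖ ^ 2) ^ (-r) * (1 + ‖y‖ ^ 2) ^ (-s)) ≤
      4 ^ s * ((1 + ‖x‖ ^ 2) ^ (-r) + (1 + ‖y‖ ^ 2) ^ (-r)) := by
  have hx := one_add_norm_sq_pos x
  have hy := one_add_norm_sq_pos y
  have hxy := norm_add_le x y
  have hx0 := norm_nonneg x
  have hy0 := norm_nonneg y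
  have hxy0 := norm_nonneg (x + y)
  rcases le_total ‖x‖ ‖y‖ with h | h
  · have h1 : 1 + ‖x + y‖ ^ 2 ≤ 4 * (1 + ‖y‖ ^ 2) := by nlinarith
    calc (1 + ‖x + y‖ ^ 2) ^ s * ((1 + ‖x‖ ^ 2) ^ (-r) * (1 + ‖y‖ ^ 2) ^ (-s))
        ≤ (4 * (1 + ‖y‖ ^ 2)) ^ s * ((1 + ‖x‖ ^ 2) ^ (-r) * (1 + ‖y‖ ^ 2) ^ (-s)) := by gcongr
      _ = 4 ^ s * (1 + ‖x‖ ^ 2) ^ (-r) := by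
        rw [Real.mul_rpow (by norm_num) hy.le, Real.rpow_neg hy.le s]
        field_simp
      _ ≤ _ := by
        gcongr
        linarith [Real.rpow_nonneg hy.le (-r)]
  · have h1 : 1 + ‖x + y‖ ^ 2 ≤ 4 * (1 + ‖x‖ ^ 2) := by nlinarith
    have h2 : (1 + ‖x‖ ^ 2) ^ (s - r) ≤ (1 + ‖y‖ ^ 2) ^ (s - r) :=
      Real.rpow_le_rpow_of_nonpos hy (by gcongr) (by linarith)
    calc (1 + ‖x + y‖ ^ 2) ^ s * ((1 + ‖x‖ ^ 2) ^ (-r) * (1 + ‖y‖ ^ 2) ^ (-s))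
        ≤ (4 * (1 + ‖x‖ ^ 2)) ^ s * ((1 + ‖x‖ ^ 2) ^ (-r) * (1 + ‖y‖ ^ 2) ^ (-s)) := by gcongr
      _ = 4 ^ s * ((1 + ‖x‖ ^ 2) ^ (s - r) * (1 + ‖y‖ ^ 2) ^ (-s)) := by
        rw [Real.mul_rpow (by norm_num) hx.le, sub_eq_add_neg, Real.rpow_add hx]
        ring
      _ ≤ 4 ^ s * ((1 + ‖y‖ ^ 2) ^ (s - r) * (1 + ‖y‖ ^ 2) ^ (-s)) := by gcongr
      _ = 4 ^ s * (1 + ‖y‖ ^ 2) ^ (-r) := by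
        rw [← Real.rpow_add hy]
        ring_nf
      _ ≤ _ := by
        gcongr
        linarith [Real.rpow_nonneg hx.le (-r)]

lemma lintegral_mul_sq_le {α : Type*} [MeasurableSpace α] {μ : Measure α} {a b : α → ℝ≥0∞}
    (ha : AEMeasurable a μ) (hb : AEMeasurable b μ) :
    (∫⁻ x, a x * b x ∂μ) ^ 2 ≤ (∫⁻ x, a x ^ 2 ∂μ) * ∫⁻ x, b x ^ 2 ∂μ := by
  have h := ENNReal.lintegral_mul_le_Lp_mul_Lq μ Real.HolderConjugate.two_two ha hb
  calc (∫⁻ x, a x * b x ∂μ) ^ 2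
      ≤ ((∫⁻ x, a x ^ (2 : ℝ) ∂μ) ^ (1 / (2 : ℝ)) * (∫⁻ x, b x ^ (2 : ℝ) ∂μ) ^ (1 / (2 : ℝ))) ^ 2 :=
        pow_le_pow_left' h 2
    _ = _ := by
      rw [mul_pow, ← ENNReal.rpow_mul_natCast, ← ENNReal.rpow_mul_natCast]
      norm_num

lemma enorm_fourier_pairing_le (m f : 𝓢(Ed d, ℂ)) (ξ : Ed d) :
    ‖𝓕 (SchwartzMap.pairing (ContinuousLinearMap.mul ℂ ℂ) m f) ξ‖ₑ ≤
      ∫⁻ η, ‖𝓕 m (ξ - η)‖ₑ * ‖𝓕 f η‖ₑ := by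
  have h1 : 𝓕⁻ (SchwartzMap.pairing (ContinuousLinearMap.mul ℂ ℂ) m f) =
      SchwartzMap.convolution (ContinuousLinearMap.mul ℂ ℂ) (𝓕⁻ m) (𝓕⁻ f) := by
    have := SchwartzMap.fourier_convolution (ContinuousLinearMap.mul ℂ ℂ) (𝓕⁻ m) (𝓕⁻ f)
    rw [FourierTransform.fourier_fourierInv_eq, FourierTransform.fourier_fourierInv_eq] at this
    rw [← this, FourierTransform.fourierInv_fourier_eq]
  have h2 (h : 𝓢(Ed d, ℂ)) (x : Ed d) : 𝓕⁻ h x = 𝓕 h (-x) := by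
    rw [SchwartzMap.fourierInv_apply_eq]; rfl
  have h3 := congrArg (fun h : 𝓢(Ed d, ℂ) => h (-ξ)) h1
  simp only [h2, neg_neg, SchwartzMap.convolution_apply] at h3
  rw [h3, MeasureTheory.convolution_def]
  refine (enorm_integral_le_lintegral_enorm _).trans_eq ?_
  rw [← lintegral_sub_right_eq_self _ ξ]
  refine lintegral_congr fun η => ?_
  rw [h2, h2, ContinuousLinearMap.mul_apply', enorm_mul]
  congr 3 <;> abel

lemma lintegral_one_add_norm_sq_rpow_ne_top {r : ℝ} (hr : (d : ℝ) / 2 < r) :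
    ∫⁻ ξ : Ed d, ENNReal.ofReal ((1 + ‖ξ‖ ^ 2) ^ (-r)) ≠ ⊤ := by
  have h := integrable_rpow_neg_one_add_norm_sq (E := Ed d) (μ := volume) (r := 2 * r)
    (by simp; linarith)
  rw [show -(2 * r) / 2 = -r by ring] at h
  exact h.lintegral_lt_top.ne

theorem exists_sobolevEnergy_mul_le {r s : ℝ} (hr : (d : ℝ) / 2 < r) (hs : 0 ≤ s) (hsr : s ≤ r) :
    ∃ K : ℝ≥0∞, K ≠ ⊤ ∧ ∀ m f : 𝓢(Ed d, ℂ),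
      sobolevEnergy s (SchwartzMap.pairing (ContinuousLinearMap.mul ℂ ℂ) m f) ≤
        K * (sobolevEnergy r m * sobolevEnergy s f) := by
  set I : ℝ≥0∞ := ∫⁻ ξ : Ed d, ENNReal.ofReal ((1 + ‖ξ‖ ^ 2) ^ (-r))
  refine ⟨ENNReal.ofReal (4 ^ s) * (I + I), ENNReal.mul_ne_top ENNReal.ofReal_ne_top
    (by simpa using lintegral_one_add_norm_sq_rpow_ne_top hr), fun m f => ?_⟩
  have hm := (𝓕 m).continuous.measurable
  have hf := (𝓕 f).continuous.measurable
  let F : Ed d → ℝ≥0∞ := fun ξ => ENNReal.ofReal ((1 + ‖ξ‖ ^ 2) ^ r * ‖𝓕 m ξ‖ ^ 2)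
  let G : Ed d → ℝ≥0∞ := fun ξ => ENNReal.ofReal ((1 + ‖ξ‖ ^ 2) ^ s * ‖𝓕 f ξ‖ ^ 2)
  have hF : Measurable F := measurable_sobolevEnergy_integrand r m
  have hG : Measurable G := measurable_sobolevEnergy_integrand s f
  have hweight : ∀ ξ : Ed d, ENNReal.ofReal ((1 + ‖ξ‖ ^ 2) ^ s) *
      ∫⁻ η, ENNReal.ofReal ((1 + ‖ξ - η‖ ^ 2) ^ (-r) * (1 + ‖η‖ ^ 2) ^ (-s)) ≤
        ENNReal.ofReal (4 ^ s) * (I + I) := by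
    intro ξ
    rw [← lintegral_const_mul' _ _ ENNReal.ofReal_ne_top]
    calc _ ≤ ∫⁻ η : Ed d, ENNReal.ofReal (4 ^ s) * (ENNReal.ofReal ((1 + ‖ξ - η‖ ^ 2) ^ (-r)) +
          ENNReal.ofReal ((1 + ‖η‖ ^ 2) ^ (-r))) := by
          refine lintegral_mono fun η => ?_
          rw [← ENNReal.ofReal_add (by positivity) (by positivity),
            ← ENNReal.ofReal_mul (by positivity), ← ENNReal.ofReal_mul (by positivity)]
          refine ENNReal.ofReal_le_ofReal ?_
          simpa using one_add_norm_add_sq_rpow_mul_le hs hsr (ξ - η) η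
      _ = _ := by
          rw [lintegral_const_mul' _ _ ENNReal.ofReal_ne_top, lintegral_add_right _ (by fun_prop),
            lintegral_sub_left_eq_self (fun η => ENNReal.ofReal ((1 + ‖η‖ ^ 2) ^ (-r))) ξ]
  have hpt : ∀ ξ : Ed d, ENNReal.ofReal ((1 + ‖ξ‖ ^ 2) ^ s *
      ‖𝓕 (SchwartzMap.pairing (ContinuousLinearMap.mul ℂ ℂ) m f) ξ‖ ^ 2) ≤
        ENNReal.ofReal (4 ^ s) * (I + I) * ∫⁻ η, F (ξ - η) * G η := by
    intro ξ
    have hsplit : ∀ η : Ed d, ‖𝓕 m (ξ - η)‖ₑ * ‖𝓕 f η‖ₑ =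
        ENNReal.ofReal ((1 + ‖ξ - η‖ ^ 2) ^ (-r / 2) * (1 + ‖η‖ ^ 2) ^ (-s / 2)) *
        ENNReal.ofReal (((1 + ‖ξ - η‖ ^ 2) ^ (r / 2) * ‖𝓕 m (ξ - η)‖) *
          ((1 + ‖η‖ ^ 2) ^ (s / 2) * ‖𝓕 f η‖)) := by
      intro η
      have h1 := one_add_norm_sq_pos (ξ - η)
      have h2 := one_add_norm_sq_pos η
      rw [← ofReal_norm, ← ofReal_norm, ← ENNReal.ofReal_mul (by positivity),
        ← ENNReal.ofReal_mul (by positivity), neg_div, neg_div, Real.rpow_neg h1.le,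
        Real.rpow_neg h2.le]
      congr 1
      field_simp
    have hCS := (pow_le_pow_left' (enorm_fourier_pairing_le m f ξ) 2)
    simp_rw [hsplit] at hCS
    have hCS := hCS.trans (lintegral_mul_sq_le (by fun_prop) (by fun_prop))
    rw [ENNReal.ofReal_mul (by positivity), ENNReal.ofReal_pow (norm_nonneg _), ofReal_norm]
    refine (mul_le_mul_right hCS _).trans ?_
    rw [← mul_assoc]
    refine mul_le_mul' (le_of_eq_of_le ?_ (hweight ξ)) (le_of_eq ?_)
    · congr 1
      refine lintegral_congr fun η => ?_
      have h1 := one_add_norm_sq_pos (ξ - η)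
      have h2 := one_add_norm_sq_pos η
      rw [← ENNReal.ofReal_pow (by positivity), mul_pow, ← Real.rpow_mul_natCast h1.le,
        ← Real.rpow_mul_natCast h2.le]
      norm_num
    · refine lintegral_congr fun η => ?_
      have h1 := one_add_norm_sq_pos (ξ - η)
      have h2 := one_add_norm_sq_pos η
      simp only [F, G]
      rw [← ENNReal.ofReal_pow (by positivity), ← ENNReal.ofReal_mul (by positivity), mul_pow,
        mul_pow, mul_pow, ← Real.rpow_mul_natCast h1.le, ← Real.rpow_mul_natCast h2.le]
      norm_num
  calc sobolevEnergy s (SchwartzMap.pairing (ContinuousLinearMap.mul ℂ ℂ) m f)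
      ≤ ∫⁻ ξ, ENNReal.ofReal (4 ^ s) * (I + I) * ∫⁻ η, F (ξ - η) * G η := lintegral_mono hpt
    _ = ENNReal.ofReal (4 ^ s) * (I + I) * ∫⁻ ξ, ∫⁻ η, F (ξ - η) * G η := by
      rw [lintegral_const_mul _ (by fun_prop)]
    _ = ENNReal.ofReal (4 ^ s) * (I + I) * ((∫⁻ ξ, F ξ) * ∫⁻ η, G η) := by
      rw [lintegral_lintegral_swap (by fun_prop)]
      congr 1
      have : ∀ η, ∫⁻ ξ, F (ξ - η) * G η = (∫⁻ ξ, F ξ) * G η := fun η => by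
        rw [lintegral_mul_const _ (by fun_prop), lintegral_sub_right_eq_self F η]
      simp_rw [this]
      rw [lintegral_const_mul _ hG]

end Product

section Interpolation

variable {d : ℕ}

/-- A quadratic version of Peetre's `K`-functional for the pair `(L², H¹)`. -/
def kEnergy {d : ℕ} (t : ℝ) (f : 𝓢(Ed d, ℂ)) : ℝ≥0∞ :=
  ∫⁻ ξ, ENNReal.ofReal ((1 + ‖ξ‖ ^ 2) / (t + (1 + ‖ξ‖ ^ 2)) * ‖𝓕 f ξ‖ ^ 2)

lemma kEnergy_add_le {t : ℝ} (ht : 0 < t) (a b : 𝓢(Ed d, ℂ)) :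
    kEnergy t (a + b) ≤ sobolevEnergy 0 a + ENNReal.ofReal t⁻¹ * sobolevEnergy 1 b := by
  unfold kEnergy sobolevEnergy
  rw [← lintegral_const_mul' _ _ ENNReal.ofReal_ne_top,
    ← lintegral_add_left (measurable_sobolevEnergy_integrand 0 a)]
  refine lintegral_mono fun ξ => ?_
  have hJ := one_add_norm_sq_pos ξ
  rw [← ENNReal.ofReal_mul (by positivity), ← ENNReal.ofReal_add (by positivity) (by positivity)]
  refine ENNReal.ofReal_le_ofReal ?_
  rw [Real.rpow_zero, Real.rpow_one, FourierTransform.fourier_add, _root_.add_apply]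
  have h := norm_add_le (𝓕 a ξ) (𝓕 b ξ)
  have h2 : ‖𝓕 a ξ + 𝓕 b ξ‖ ^ 2 ≤ (‖𝓕 a ξ‖ + ‖𝓕 b ξ‖) ^ 2 := by gcongr
  refine (mul_le_mul_of_nonneg_left h2 (by positivity)).trans ?_
  rw [← sub_nonneg]
  have h3 : 0 ≤ (t * ‖𝓕 a ξ‖ - (1 + ‖ξ‖ ^ 2) * ‖𝓕 b ξ‖) ^ 2 / (t * (t + (1 + ‖ξ‖ ^ 2))) := by
    positivity
  refine h3.trans_eq ?_
  field_simp
  ring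

lemma exists_kEnergy_eq {t : ℝ} (ht : 0 < t) (f : 𝓢(Ed d, ℂ)) :
    ∃ a b : 𝓢(Ed d, ℂ), f = a + b ∧
      sobolevEnergy 0 a + ENNReal.ofReal t⁻¹ * sobolevEnergy 1 b = kEnergy t f := by
  let w : Ed d → ℝ := fun ξ => t * (t + 1)⁻¹ * (1 + ‖(√(t + 1))⁻¹ • ξ‖ ^ 2) ^ (-1 : ℝ)
  have hw : w.HasTemperateGrowth := by
    have h1 := (Function.hasTemperateGrowth_one_add_norm_sq_rpow (Ed d) (-1)).comp
      (f := fun ξ : Ed d => (√(t + 1))⁻¹ • ξ) (by fun_prop)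
    exact (Function.HasTemperateGrowth.const _).mul h1
  have hw_eq : ∀ ξ, w ξ = t / (t + (1 + ‖ξ‖ ^ 2)) := by
    intro ξ
    have hJ := one_add_norm_sq_pos ξ
    simp only [w]
    rw [norm_smul, mul_pow, Real.norm_of_nonneg (by positivity), inv_pow,
      Real.sq_sqrt (by positivity), Real.rpow_neg_one]
    field_simp
    ring
  let b : 𝓢(Ed d, ℂ) := 𝓕⁻ (SchwartzMap.smulLeftCLM ℂ w (𝓕 f))
  have hb : ∀ ξ, 𝓕 b ξ = w ξ • 𝓕 f ξ := by
    intro ξ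
    simp only [b]
    rw [FourierTransform.fourier_fourierInv_eq, SchwartzMap.smulLeftCLM_apply_apply hw]
  have ha : ∀ ξ, 𝓕 (f - b) ξ = (1 - w ξ) • 𝓕 f ξ := by
    intro ξ
    rw [sub_eq_add_neg f b, FourierTransform.fourier_add, FourierTransform.fourier_neg,
      ← sub_eq_add_neg, _root_.sub_apply, hb, sub_smul, one_smul]
  refine ⟨f - b, b, by abel, ?_⟩
  unfold kEnergy sobolevEnergy
  rw [← lintegral_const_mul' _ _ ENNReal.ofReal_ne_top,
    ← lintegral_add_left (measurable_sobolevEnergy_integrand 0 _)]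
  refine lintegral_congr fun ξ => ?_
  have hJ := one_add_norm_sq_pos ξ
  rw [← ENNReal.ofReal_mul (by positivity), ← ENNReal.ofReal_add (by positivity) (by positivity),
    hb, ha, norm_smul, norm_smul, hw_eq, mul_pow, mul_pow, Real.norm_eq_abs, Real.norm_eq_abs,
    sq_abs, sq_abs, Real.rpow_zero, Real.rpow_one]
  congr 1
  field_simp
  ring

lemma lintegral_rpow_mul_div_add {θ x : ℝ} (hθ : θ ∈ Ioo (0 : ℝ) 1) (hx : 0 < x) :
    ∫⁻ t in Ioi (0 : ℝ), ENNReal.ofReal (t ^ (θ - 1) * (x / (t + x))) =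
      ENNReal.ofReal (∫ t in Ioi 0, Real.rpowIntegrand₀₁ θ t 1) * ENNReal.ofReal (x ^ θ) := by
  rw [← ENNReal.ofReal_mul (Real.integral_rpowIntegrand₀₁_one_pos hθ).le, mul_comm,
    ← Real.integral_rpowIntegrand₀₁_eq_rpow_mul_const hθ hx.le,
    ofReal_integral_eq_lintegral_ofReal (Real.integrableOn_rpowIntegrand₀₁_Ioi hθ hx.le)]
  · refine setLIntegral_congr_fun measurableSet_Ioi fun t ht => ?_
    rw [Real.rpowIntegrand₀₁_eq_pow_div hθ (le_of_lt ht) hx.le, mul_div_assoc]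
  · exact (ae_restrict_iff' measurableSet_Ioi).2 <| .of_forall fun t ht =>
      Real.rpowIntegrand₀₁_nonneg hθ.1 (le_of_lt ht) hx.le

lemma lintegral_rpow_mul_kEnergy {θ : ℝ} (hθ : θ ∈ Ioo (0 : ℝ) 1) (f : 𝓢(Ed d, ℂ)) :
    ∫⁻ t in Ioi (0 : ℝ), ENNReal.ofReal (t ^ (θ - 1)) * kEnergy t f =
      ENNReal.ofReal (∫ t in Ioi 0, Real.rpowIntegrand₀₁ θ t 1) * sobolevEnergy θ f := by
  have hf := (𝓕 f).continuous.measurable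
  unfold kEnergy sobolevEnergy
  simp_rw [← lintegral_const_mul' _ _ ENNReal.ofReal_ne_top]
  rw [lintegral_lintegral_swap (by fun_prop)]
  refine lintegral_congr fun ξ => ?_
  have hJ := one_add_norm_sq_pos ξ
  rw [ENNReal.ofReal_mul (by positivity), ← mul_assoc, ← lintegral_rpow_mul_div_add hθ hJ,
    ← lintegral_mul_const' _ _ ENNReal.ofReal_ne_top]
  refine setLIntegral_congr_fun measurableSet_Ioi fun t ht => ?_
  have ht : 0 < t := ht
  rw [← ENNReal.ofReal_mul (by positivity), ← ENNReal.ofReal_mul (by positivity), mul_assoc]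

theorem sobolevEnergy_map_le_of_mem_Ioo {θ : ℝ} (hθ : θ ∈ Ioo (0 : ℝ) 1)
    (T : 𝓢(Ed d, ℂ) →ₗ[ℂ] 𝓢(Ed d, ℂ)) {M : ℝ≥0∞} (hM : M ≠ ⊤)
    (h0 : ∀ f, sobolevEnergy 0 (T f) ≤ M * sobolevEnergy 0 f)
    (h1 : ∀ f, sobolevEnergy 1 (T f) ≤ M * sobolevEnergy 1 f) (f : 𝓢(Ed d, ℂ)) :
    sobolevEnergy θ (T f) ≤ M * sobolevEnergy θ f := by
  have hc := Real.integral_rpowIntegrand₀₁_one_pos hθ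
  have hK : ∀ t ∈ Ioi (0 : ℝ), ENNReal.ofReal (t ^ (θ - 1)) * kEnergy t (T f) ≤
      M * (ENNReal.ofReal (t ^ (θ - 1)) * kEnergy t f) := by
    intro t ht
    obtain ⟨a, b, rfl, hab⟩ := exists_kEnergy_eq ht f
    rw [mul_left_comm]
    refine mul_le_mul_right ?_ _
    rw [map_add, ← hab, mul_add, mul_left_comm]
    exact (kEnergy_add_le ht _ _).trans (add_le_add (h0 a) (mul_le_mul_right (h1 b) _))
  have := (setLIntegral_mono' (μ := volume) measurableSet_Ioi hK).trans_eq
    (lintegral_const_mul' _ _ hM)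
  rw [lintegral_rpow_mul_kEnergy hθ, lintegral_rpow_mul_kEnergy hθ, mul_left_comm] at this
  exact (ENNReal.mul_le_mul_iff_right (by simpa using hc) ENNReal.ofReal_ne_top).1 this

end Interpolation

section Composition

variable {d : ℕ}

lemma hasTemperateGrowth_id_add (g : 𝓢(Ed d, Ed d)) :
    (fun x => x + g x).HasTemperateGrowth :=
  Function.HasTemperateGrowth.id'.add g.hasTemperateGrowth

lemma exists_norm_le_mul_one_add_norm_id_add (g : 𝓢(Ed d, Ed d)) :
    ∃ (k : ℕ) (C : ℝ), ∀ x, ‖x‖ ≤ C * (1 + ‖x + g x‖) ^ k := by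
  obtain ⟨B, hB⟩ := g.decay 0 0
  refine ⟨1, 1 + B, fun x => ?_⟩
  have h1 : ‖g x‖ ≤ B := by simpa using hB.2 x
  have h2 : ‖x‖ ≤ ‖x + g x‖ + ‖g x‖ := by simpa using norm_sub_le (x + g x) (g x)
  nlinarith [norm_nonneg (x + g x), norm_nonneg (g x)]

/-- Right translation `u ↦ u ∘ (id + g)` on Schwartz functions. -/
def rightTranslation {d : ℕ} (g : 𝓢(Ed d, Ed d)) : 𝓢(Ed d, ℂ) →L[ℂ] 𝓢(Ed d, ℂ) :=
  SchwartzMap.compCLM ℂ (hasTemperateGrowth_id_add g) (exists_norm_le_mul_one_add_norm_id_add g)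

@[simp]
lemma rightTranslation_apply (g : 𝓢(Ed d, Ed d)) (u : 𝓢(Ed d, ℂ)) (x : Ed d) :
    rightTranslation g u x = u (x + g x) := rfl

/-- The `i`-th component of a Schwartz map, as a complex-valued Schwartz function. -/
def component {d : ℕ} (i : Fin d) (g : 𝓢(Ed d, Ed d)) : 𝓢(Ed d, ℂ) :=
  g.postcompCLM (Complex.ofRealCLM ∘L EuclideanSpace.proj i)

lemma sobolevEnergy_zero_rightTranslation_le {c : ℝ} (hc : 0 < c) (g : 𝓢(Ed d, Ed d))
    (hdet : c < ⨅ x : Ed d, (ContinuousLinearMap.id ℝ (Ed d) + fderiv ℝ (⇑g) x).det)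
    (hg : Function.Bijective fun x : Ed d => x + g x) (u : 𝓢(Ed d, ℂ)) :
    sobolevEnergy 0 (rightTranslation g u) ≤ ENNReal.ofReal c⁻¹ * sobolevEnergy 0 u := by
  have hbdd : BddBelow (range fun x : Ed d =>
      (ContinuousLinearMap.id ℝ (Ed d) + fderiv ℝ (⇑g) x).det) := by
    by_contra h
    rw [Real.iInf_of_not_bddBelow h] at hdet
    linarith
  have hdet' : ∀ x, c ≤ |(ContinuousLinearMap.id ℝ (Ed d) + fderiv ℝ (⇑g) x).det| := fun x =>
    (hdet.le.trans (ciInf_le hbdd x)).trans (le_abs_self _)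
  have hφ : ∀ x, HasFDerivAt (fun x => x + g x)
      (ContinuousLinearMap.id ℝ (Ed d) + fderiv ℝ (⇑g) x) x := fun x =>
    (hasFDerivAt_id x).add g.differentiableAt.hasFDerivAt
  have hcv := lintegral_image_eq_lintegral_abs_det_fderiv_mul volume MeasurableSet.univ
    (fun x _ => (hφ x).hasFDerivWithinAt)
    hg.injective.injOn (fun y => ENNReal.ofReal (‖u y‖ ^ 2))
  rw [image_univ, hg.surjective.range_eq, Measure.restrict_univ] at hcv
  rw [sobolevEnergy_zero_eq, sobolevEnergy_zero_eq, hcv,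
    ← lintegral_const_mul' _ _ ENNReal.ofReal_ne_top]
  refine lintegral_mono fun x => ?_
  rw [← mul_assoc, ← ENNReal.ofReal_mul (by positivity)]
  refine le_mul_of_one_le_left zero_le ?_
  rw [ENNReal.one_le_ofReal, inv_mul_eq_div, one_le_div hc]
  exact hdet' x

lemma lineDeriv_rightTranslation (g : 𝓢(Ed d, Ed d)) (u : 𝓢(Ed d, ℂ)) (j : Fin d) :
    ∂_{EuclideanSpace.single j (1 : ℝ)} (rightTranslation g u) =
      rightTranslation g (∂_{EuclideanSpace.single j (1 : ℝ)} u) +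
        ∑ i, SchwartzMap.pairing (ContinuousLinearMap.mul ℂ ℂ)
          (∂_{EuclideanSpace.single j (1 : ℝ)} (component i g))
          (rightTranslation g (∂_{EuclideanSpace.single i (1 : ℝ)} u)) := by
  ext x
  have hφ : HasFDerivAt (fun x => x + g x) (ContinuousLinearMap.id ℝ (Ed d) + fderiv ℝ g x) x :=
    (hasFDerivAt_id x).add g.differentiableAt.hasFDerivAt
  have hR : HasFDerivAt (rightTranslation g u) (fderiv ℝ u (x + g x) ∘L
      (ContinuousLinearMap.id ℝ (Ed d) + fderiv ℝ g x)) x :=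
    HasFDerivAt.comp (g := u) x (u.differentiableAt (x := x + g x)).hasFDerivAt hφ
  have hcomp : ∀ i, HasFDerivAt (component i g)
      ((Complex.ofRealCLM ∘L EuclideanSpace.proj i) ∘L fderiv ℝ g x) x := fun i =>
    (Complex.ofRealCLM ∘L EuclideanSpace.proj i).hasFDerivAt.comp x
      g.differentiableAt.hasFDerivAt
  have hsum : ∀ v : Ed d, v = ∑ i, v i • EuclideanSpace.single i (1 : ℝ) := fun v => by
    simpa using ((EuclideanSpace.basisFun (Fin d) ℝ).sum_repr v).symm
  simp only [_root_.add_apply, _root_.sum_apply, SchwartzMap.pairing_apply_apply,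
    SchwartzMap.lineDerivOp_apply_eq_fderiv, rightTranslation_apply, hR.fderiv, (hcomp _).fderiv,
    ContinuousLinearMap.comp_apply, ContinuousLinearMap.id_apply, map_add]
  congr 1
  conv_lhs => rw [hsum (fderiv ℝ g x (EuclideanSpace.single j 1))]
  simp

end Composition

section UniformBound

variable {d : ℕ}

/-- The right translations by `id + g`, `g ∈ G`, are bounded on `H^s` uniformly in `g`. -/
def UniformlyBoundedOn {d : ℕ} (G : Set 𝓢(Ed d, Ed d)) (s : ℝ) : Prop :=
  ∃ M : ℝ≥0∞, M ≠ ⊤ ∧ ∀ g ∈ G, ∀ u : 𝓢(Ed d, ℂ),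
    sobolevEnergy s (rightTranslation g u) ≤ M * sobolevEnergy s u

variable {G : Set 𝓢(Ed d, Ed d)}

lemma UniformlyBoundedOn.of_mem_Icc (h0 : UniformlyBoundedOn G 0) (h1 : UniformlyBoundedOn G 1)
    {θ : ℝ} (hθ : θ ∈ Icc (0 : ℝ) 1) : UniformlyBoundedOn G θ := by
  rcases hθ.1.eq_or_lt with rfl | hθ0
  · exact h0
  rcases hθ.2.eq_or_lt with rfl | hθ1
  · exact h1
  obtain ⟨M₀, hM₀, hb₀⟩ := h0
  obtain ⟨M₁, hM₁, hb₁⟩ := h1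
  refine ⟨M₀ + M₁, ENNReal.add_ne_top.2 ⟨hM₀, hM₁⟩, fun g hg =>
    sobolevEnergy_map_le_of_mem_Ioo ⟨hθ0, hθ1⟩ (rightTranslation g).toLinearMap
      (ENNReal.add_ne_top.2 ⟨hM₀, hM₁⟩) (fun f => (hb₀ g hg f).trans ?_)
      (fun f => (hb₁ g hg f).trans ?_)⟩
  · exact mul_le_mul_left le_self_add _
  · exact mul_le_mul_left le_add_self _

lemma UniformlyBoundedOn.add_one {q s : ℝ} {B : ℝ≥0∞} (hB : B ≠ ⊤)
    (hG : ∀ g ∈ G, ∀ i, sobolevEnergy q (component i g) ≤ B) (hq : (d : ℝ) / 2 < q - 1)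
    (hs : 0 ≤ s) (hsq : s ≤ q - 1) (h : UniformlyBoundedOn G s) :
    UniformlyBoundedOn G (s + 1) := by
  obtain ⟨M, hM, hbM⟩ := h
  obtain ⟨K, hK, hbK⟩ := exists_sobolevEnergy_mul_le hq hs hsq
  set P : ℝ≥0∞ := ENNReal.ofReal ((2 * Real.pi) ^ 2)
  have hP : P ≠ ⊤ := ENNReal.ofReal_ne_top
  refine ⟨M + d * (2 * (M * P + 2 ^ d * (d * (K * (P * B * (M * P)))))), ?_, fun g hg u => ?_⟩
  · finiteness
  have h1 : ∀ i, sobolevEnergy s (rightTranslation g (∂_{EuclideanSpace.single i (1 : ℝ)} u)) ≤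
      M * (P * sobolevEnergy (s + 1) u) := fun i =>
    (hbM g hg _).trans (mul_le_mul_right (sobolevEnergy_lineDeriv_le s u i) _)
  have h2 : ∀ i j : Fin d, sobolevEnergy (q - 1)
      (∂_{EuclideanSpace.single j (1 : ℝ)} (component i g)) ≤ P * B := fun i j =>
    (sobolevEnergy_lineDeriv_le (q - 1) (component i g) j).trans
      (mul_le_mul_right (by simpa using hG g hg i) _)
  have h3 : ∀ j : Fin d, sobolevEnergy s
      (∂_{EuclideanSpace.single j (1 : ℝ)} (rightTranslation g u)) ≤
      2 * (M * (P * sobolevEnergy (s + 1) u) +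
        2 ^ d * ∑ _i : Fin d, K * (P * B * (M * (P * sobolevEnergy (s + 1) u)))) := by
    intro j
    rw [lineDeriv_rightTranslation]
    refine (sobolevEnergy_add_le _ _ _).trans (mul_le_mul_right (add_le_add (h1 j) ?_) _)
    refine (sobolevEnergy_sum_le _ _ _).trans ?_
    rw [Finset.card_univ, Fintype.card_fin]
    refine mul_le_mul_right (Finset.sum_le_sum fun i _ => (hbK _ _).trans ?_) _
    exact mul_le_mul_right (mul_le_mul' (h2 i j) (h1 i)) _
  calc sobolevEnergy (s + 1) (rightTranslation g u)
      ≤ M * sobolevEnergy (s + 1) u + ∑ _j : Fin d, 2 * (M * (P * sobolevEnergy (s + 1) u) +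
        2 ^ d * ∑ _i : Fin d, K * (P * B * (M * (P * sobolevEnergy (s + 1) u)))) := by
        refine (sobolevEnergy_add_one_le s _).trans
          (add_le_add ?_ (Finset.sum_le_sum fun j _ => h3 j))
        exact (hbM g hg u).trans (mul_le_mul_right (sobolevEnergy_mono (by linarith) u) _)
    _ = _ := by
      simp only [Finset.sum_const, Finset.card_univ, Fintype.card_fin, nsmul_eq_mul]
      ring

theorem UniformlyBoundedOn.of_zero {q : ℝ} {B : ℝ≥0∞} (hB : B ≠ ⊤)
    (hG : ∀ g ∈ G, ∀ i, sobolevEnergy q (component i g) ≤ B) (hq : (d : ℝ) / 2 < q - 1)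
    (h0 : UniformlyBoundedOn G 0) {p : ℝ} (hp0 : 0 ≤ p) (hpq : p ≤ q) :
    UniformlyBoundedOn G p := by
  have hd : (0 : ℝ) ≤ (d : ℝ) / 2 := by positivity
  have key : ∀ (n : ℕ) (p : ℝ), 0 ≤ p → p ≤ q → p ≤ n + 1 → UniformlyBoundedOn G p := by
    intro n
    induction n with
    | zero =>
      intro p hp0 hpq hpn
      have h1 : UniformlyBoundedOn G 1 := by
        simpa using h0.add_one hB hG hq le_rfl (by linarith)
      exact h0.of_mem_Icc h1 ⟨hp0, by simpa using hpn⟩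
    | succ n ih =>
      intro p hp0 hpq hpn
      push_cast at hpn
      rcases le_total p 1 with hp1 | hp1
      · exact ih p hp0 hpq (by linarith [n.cast_nonneg (α := ℝ)])
      · have := (ih (p - 1) (by linarith) (by linarith) (by linarith)).add_one hB hG hq
          (by linarith) (by linarith)
        rwa [sub_add_cancel] at this
  obtain ⟨n, hn⟩ := exists_nat_ge p
  exact key n p hp0 hpq (by linarith)

lemma sobolevEnergy_eq_ofReal_HNorm_sq (s : ℝ) (f : 𝓢(Ed d, ℂ)) :
    sobolevEnergy s f = ENNReal.ofReal (HNorm s f ^ 2) := by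
  rw [HNorm_eq_sobolevEnergy, ← Real.rpow_mul_natCast ENNReal.toReal_nonneg]
  norm_num [ENNReal.ofReal_toReal (sobolevEnergy_ne_top s f)]

lemma HNorm_nonneg (s : ℝ) (f : 𝓢(Ed d, ℂ)) : 0 ≤ HNorm s f := by
  rw [HNorm_eq_sobolevEnergy]
  positivity

lemma sobolevEnergy_component_le {s C : ℝ} {g : 𝓢(Ed d, Ed d)} (hg : HNormV s g < C)
    (i : Fin d) : sobolevEnergy s (component i g) ≤ ENNReal.ofReal (C ^ 2) := by
  rw [sobolevEnergy_eq_ofReal_HNorm_sq]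
  refine ENNReal.ofReal_le_ofReal ?_
  have h1 : HNorm s (component i g) ^ 2 ≤
      ∑ i : Fin d, HNorm s (fun x => ((g x i : ℝ) : ℂ)) ^ 2 :=
    Finset.single_le_sum (f := fun i => HNorm s (fun x => ((g x i : ℝ) : ℂ)) ^ 2)
      (fun i _ => sq_nonneg _) (Finset.mem_univ i)
  have h0 := (sq_nonneg _).trans h1
  refine h1.trans ?_
  unfold HNormV at hg
  rw [← Real.sqrt_eq_rpow] at hg
  exact ((Real.sqrt_lt' ((Real.sqrt_nonneg _).trans_lt hg)).1 hg).le

end UniformBound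

end Helpers

/-- Local boundedness of the right-translation operator `R_φ : u ↦ u∘φ` on `H^p`,
uniformly over diffeomorphisms `φ = id + g` with `‖g‖_{H^q} < C₁` and
`inf det(I + dg) > C₂`. -/
theorem right_translation_locally_bounded (d : ℕ) (hd : 1 ≤ d) (q p : ℝ)
    (hq : 1 + (d : ℝ) / 2 < q) (hp0 : 0 ≤ p) (hpq : p ≤ q)
    (C₁ C₂ : ℝ) (hC₁ : 0 < C₁) (hC₂ : 0 < C₂) :
    ∃ C > 0, ∀ g : SchwartzMap (Ed d) (Ed d),
      HNormV q ⇑g < C₁ →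
      C₂ < ⨅ x : Ed d, (ContinuousLinearMap.id ℝ (Ed d) + fderiv ℝ (⇑g) x).det →
      Function.Bijective (fun x : Ed d => x + g x) →
      ∀ u : SchwartzMap (Ed d) ℂ,
        (∃ v : SchwartzMap (Ed d) ℂ, ∀ x : Ed d, v x = u (x + g x)) ∧
        HNorm p (fun x => u (x + g x)) ≤ C * HNorm p ⇑u := by
  let G : Set (SchwartzMap (Ed d) (Ed d)) := {g | HNormV q ⇑g < C₁ ∧
    C₂ < ⨅ x : Ed d, (ContinuousLinearMap.id ℝ (Ed d) + fderiv ℝ (⇑g) x).det ∧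
    Function.Bijective (fun x : Ed d => x + g x)}
  have h0 : UniformlyBoundedOn G 0 := ⟨ENNReal.ofReal C₂⁻¹, ENNReal.ofReal_ne_top, fun g hg =>
    sobolevEnergy_zero_rightTranslation_le hC₂ g hg.2.1 hg.2.2⟩
  obtain ⟨M, hM, hbM⟩ := h0.of_zero ENNReal.ofReal_ne_top
    (fun g hg => sobolevEnergy_component_le hg.1) (by linarith) hp0 hpq
  refine ⟨√(M.toReal + 1), by positivity, fun g hg hdet hbij u =>
    ⟨⟨rightTranslation g u, fun _ => rfl⟩, ?_⟩⟩
  have h := hbM g ⟨hg, hdet, hbij⟩ u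
  change HNorm p ⇑(rightTranslation g u) ≤ _
  rw [sobolevEnergy_eq_ofReal_HNorm_sq, sobolevEnergy_eq_ofReal_HNorm_sq,
    ← ENNReal.ofReal_toReal hM, ← ENNReal.ofReal_mul ENNReal.toReal_nonneg,
    ENNReal.ofReal_le_ofReal_iff (by positivity)] at h
  refine le_of_sq_le_sq ?_ (mul_nonneg (Real.sqrt_nonneg _) (HNorm_nonneg p u))
  rw [mul_pow, Real.sq_sqrt (by positivity)]
  nlinarith [sq_nonneg (HNorm p u)]
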